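/- In ℍ⁶ with the componentwise real inner product, let V̄ = {(G₁ − S, 0, −S, G₁ − T, G₂ − T, σ·i − T) : G₁, G₂, S, T ∈ Im ℍ, σ ∈ ℝ}. Let X, A ∈ span_ℝ{j, k} ⊂ ℍ and B ∈ ℍ, and write [p, q] = p·q − q·p. Then [X, A] ∈ span_ℝ{i}, and the orthogonal projection of the vector (−(5/2)·[X,A], −[X,B], (7/2)·[X,A], (3/2)·[X,A], 0, −(1/2)·[X,A]) ∈ ℍ⁶ onto V̄ equals (−(5/2)·[X,A], 0, (7/2)·[X,A], (3/2)·[X,A], 0, −(1/2)·[X,A]). (This computes the O'Neill A-tensor A(X̄, Ȳ) at q̄₀ for two horizontal directions tangent to the soul.) -/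

import Mathlib

open scoped Quaternion RealInnerProductSpace

noncomputable section

/-- The quaternion `i`. -/
def qi : ℍ := ⟨0, 1, 0, 0⟩

/-- The quaternion `j`. -/
def qj : ℍ := ⟨0, 0, 1, 0⟩

/-- The quaternion `k`. -/
def qk : ℍ := ⟨0, 0, 0, 1⟩

/-- The componentwise real inner product on `ℍ⁶`. -/
def ip (p q : Fin 6 → ℍ) : ℝ := ∑ i, ⟪p i, q i⟫

/-- The vertical space `V̄` at `q̄₀ = (1,0,1,1,1,1)`. -/
def Vbar : Set (Fin 6 → ℍ) :=
  {v | ∃ G₁ G₂ S T : ℍ, ∃ σ : ℝ, G₁.re = 0 ∧ G₂.re = 0 ∧ S.re = 0 ∧ T.re = 0 ∧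
    v = ![G₁ - S, 0, -S, G₁ - T, G₂ - T, σ • qi - T]}

/-- The commutator of two elements of `span {j, k}` is a real multiple of `i`. -/
theorem commutator_eq_smul_qi {X A : ℍ}
    (hX : X ∈ Submodule.span ℝ ({qj, qk} : Set ℍ))
    (hA : A ∈ Submodule.span ℝ ({qj, qk} : Set ℍ)) :
    ∃ t : ℝ, X * A - A * X = t • qi := by
  obtain ⟨a, b, rfl⟩ := Submodule.mem_span_pair.1 hX
  obtain ⟨c, d, rfl⟩ := Submodule.mem_span_pair.1 hA
  refine ⟨2 * (a * d - b * c), ?_⟩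
  ext <;> simp <;> simp [qi, qj, qk] <;> ring

/-- For `X, A ∈ span{j,k}` and `B ∈ ℍ`, the commutator `[X,A]` lies in `span{i}`, and the
orthogonal projection of `(−(5/2)[X,A], −[X,B], (7/2)[X,A], (3/2)[X,A], 0, −(1/2)[X,A])`
onto the vertical space `V̄` is `(−(5/2)[X,A], 0, (7/2)[X,A], (3/2)[X,A], 0, −(1/2)[X,A])`. -/
theorem stmt_16 (X A : ℍ)
    (hX : X ∈ Submodule.span ℝ ({qj, qk} : Set ℍ))
    (hA : A ∈ Submodule.span ℝ ({qj, qk} : Set ℍ))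
    (B : ℍ)
    (u p : Fin 6 → ℍ)
    (hu : u = ![-(5 / 2 : ℝ) • (X * A - A * X), -(X * B - B * X),
      (7 / 2 : ℝ) • (X * A - A * X), (3 / 2 : ℝ) • (X * A - A * X), 0,
      -(1 / 2 : ℝ) • (X * A - A * X)])
    (hp : p = ![-(5 / 2 : ℝ) • (X * A - A * X), 0,
      (7 / 2 : ℝ) • (X * A - A * X), (3 / 2 : ℝ) • (X * A - A * X), 0,
      -(1 / 2 : ℝ) • (X * A - A * X)]) :
    (X * A - A * X) ∈ Submodule.span ℝ ({qi} : Set ℍ) ∧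
    p ∈ Vbar ∧ ∀ v ∈ Vbar, ip (u - p) v = 0 := by
  obtain ⟨t, ht⟩ : ∃ t : ℝ, X * A - A * X = t • qi := commutator_eq_smul_qi hX hA
  rw [ht] at hu hp ⊢
  refine ⟨Submodule.mem_span_singleton.2 ⟨t, rfl⟩, ?_, ?_⟩
  · have hqi : qi.re = 0 := rfl
    refine ⟨(-6 * t) • qi, (-(15 / 2) * t) • qi, (-(7 / 2) * t) • qi, (-(15 / 2) * t) • qi,
      -8 * t, by simp [hqi], by simp [hqi], by simp [hqi], by simp [hqi], ?_⟩
    rw [hp]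
    congr! 1
    · module
    congr! 1
    congr! 1
    · module
    congr! 1
    · module
    congr! 1
    · module
    congr! 1
    module
  · rintro v ⟨G₁, G₂, S, T, σ, -, -, -, -, rfl⟩
    simp [ip, hu, hp, Fin.sum_univ_succ]
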